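/- arXiv:math/0511358 — 3 statements merged into one kernel-verified Lean document; each statement's English description precedes it below -/
import Mathlib

section
/- Let d be a positive integer and let a, b be integers with 0 ≤ a, b < d and gcd(a, b) = 1. Then there is a constant C (depending only on d) such that for every integer Q ≥ 2, the number of pairs of integers (m, n) with 1 ≤ m, n ≤ Q, m + n > Q, gcd(m, n) = 1, m ≡ a (mod d) and n ≡ b (mod d) equals (3 Q²/(π² d²)) · ∏_{p prime, p ∣ d} (1 − 1/p²)^{−1} + E with |E| ≤ C · Q · log Q. -/
open Finset in
/-- The half-open interval `(s, t]` contains `(t - s) / D + O(1)` elements of a residue class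
modulo `D`. -/
theorem abs_card_Ioc_filter_modEq_sub_le {D : ℕ} (hD : 0 < D) {s t : ℕ} (hst : s ≤ t) (v : ℕ) :
    |(#{x ∈ Ioc s t | x ≡ v [MOD D]} : ℝ) - ((t : ℝ) - s) / D| ≤ 1 := by
  have hcard := Nat.Ioc_filter_modEq_card s t hD v
  have hle : ((s : ℚ) - v) / D ≤ ((t : ℚ) - v) / D := by gcongr
  rw [max_eq_left (sub_nonneg.2 (Int.floor_mono hle))] at hcard
  have key : |(#{x ∈ Ioc s t | x ≡ v [MOD D]} : ℚ) - ((t : ℚ) - s) / D| ≤ 1 := by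
    have hcast : (#{x ∈ Ioc s t | x ≡ v [MOD D]} : ℚ) =
        (⌊((t : ℚ) - v) / D⌋ : ℚ) - (⌊((s : ℚ) - v) / D⌋ : ℚ) := by exact_mod_cast hcard
    have hsub : ((t : ℚ) - s) / D = ((t : ℚ) - v) / D - ((s : ℚ) - v) / D := by ring
    rw [hcast, hsub, abs_le]
    have h₁ := Int.floor_le (((t : ℚ) - v) / D)
    have h₂ := Int.lt_floor_add_one (((t : ℚ) - v) / D)
    have h₃ := Int.floor_le (((s : ℚ) - v) / D)
    have h₄ := Int.lt_floor_add_one (((s : ℚ) - v) / D)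
    constructor <;> linarith
  have key' := (Rat.cast_le (K := ℝ)).2 key
  push_cast at key'
  exact key'

open Finset in
theorem sum_range_const_sub_self (Q : ℕ) :
    ∑ j ∈ range Q, ((Q : ℝ) - j) = (Q : ℝ) * (Q + 1) / 2 := by
  induction Q with
  | zero => simp
  | succ k ih =>
    rw [sum_range_succ]
    have : ∑ j ∈ range k, (((k + 1 : ℕ) : ℝ) - j) = ∑ j ∈ range k, ((k : ℝ) - j) + k := by
      rw [← sub_eq_iff_eq_add', ← sum_sub_distrib]
      simp
    rw [this, ih]
    push_cast
    ring

open Finset in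
/-- The sum of the elements of a residue class modulo `D` in `[1, Q]`. -/
theorem abs_sum_filter_modEq_sub_le {D : ℕ} (hD : 0 < D) (Q u : ℕ) :
    |∑ m ∈ Ioc 0 Q with m ≡ u [MOD D], (m : ℝ) - (Q : ℝ) * (Q + 1) / 2 / D| ≤ (Q : ℝ) := by
  have hswap : ∑ m ∈ Ioc 0 Q with m ≡ u [MOD D], (m : ℝ) =
      ∑ j ∈ range Q, (#{m ∈ Ioc j Q | m ≡ u [MOD D]} : ℝ) := by
    have hm : ∀ m ∈ {m ∈ Ioc 0 Q | m ≡ u [MOD D]},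
        (m : ℝ) = ∑ j ∈ range Q, if j < m then (1 : ℝ) else 0 := by
      intro m hm
      have hmQ : m ≤ Q := (mem_Ioc.1 (mem_filter.1 hm).1).2
      have : {j ∈ range Q | j < m} = range m := by
        ext j
        simp only [mem_filter, mem_range]
        omega
      rw [sum_boole, this, card_range]
    rw [sum_congr rfl hm, sum_comm]
    refine sum_congr rfl fun j _ ↦ ?_
    rw [sum_boole]
    congr 2
    ext m
    simp only [mem_filter, mem_Ioc]
    constructor
    · rintro ⟨⟨⟨_, h₁⟩, h₂⟩, h₃⟩
      exact ⟨⟨h₃, h₁⟩, h₂⟩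
    · rintro ⟨⟨h₃, h₁⟩, h₂⟩
      exact ⟨⟨⟨by omega, h₁⟩, h₂⟩, h₃⟩
  rw [hswap, ← sum_range_const_sub_self, sum_div, ← sum_sub_distrib]
  calc _ ≤ ∑ j ∈ range Q, |(#{m ∈ Ioc j Q | m ≡ u [MOD D]} : ℝ) - ((Q : ℝ) - j) / D| :=
        abs_sum_le_sum_abs _ _
    _ ≤ ∑ j ∈ range Q, (1 : ℝ) := sum_le_sum fun j hj ↦
        abs_card_Ioc_filter_modEq_sub_le hD (mem_range.1 hj).le u
    _ = (Q : ℝ) := by simp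

open Finset in
/-- The Farey triangle of order `Q` contains `Q² / (2D²) + O(Q / D + 1)` points of a translate of
the lattice `D ℤ²`. -/
theorem abs_card_farey_triangle_modEq_sub_le {D : ℕ} (hD : 0 < D) (Q u v : ℕ) :
    |(#{mn ∈ Icc 1 Q ×ˢ Icc 1 Q |
        Q < mn.1 + mn.2 ∧ mn.1 ≡ u [MOD D] ∧ mn.2 ≡ v [MOD D]} : ℝ)
      - (Q : ℝ) ^ 2 / (2 * (D : ℝ) ^ 2)| ≤ 3 * ((Q : ℝ) / D) + 1 := by
  have hD' : (1 : ℝ) ≤ D := by exact_mod_cast hD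
  have hcard : (#{mn ∈ Icc 1 Q ×ˢ Icc 1 Q |
        Q < mn.1 + mn.2 ∧ mn.1 ≡ u [MOD D] ∧ mn.2 ≡ v [MOD D]} : ℝ) =
      ∑ m ∈ Ioc 0 Q with m ≡ u [MOD D], (#{n ∈ Ioc (Q - m) Q | n ≡ v [MOD D]} : ℝ) := by
    rw [← sum_boole, sum_product, sum_filter]
    refine sum_congr rfl fun m hm ↦ ?_
    have hmQ := mem_Icc.1 hm
    rw [sum_boole]
    split_ifs with hmu
    · congr 2
      ext n
      simp only [mem_filter, mem_Ioc, mem_Icc, hmu, true_and]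
      constructor
      · rintro ⟨_, _, h⟩
        exact ⟨by omega, h⟩
      · rintro ⟨_, h⟩
        exact ⟨by omega, by omega, h⟩
    · simp [hmu]
  set A := {m ∈ Ioc 0 Q | m ≡ u [MOD D]} with hA
  have hAcard : (#A : ℝ) ≤ Q / D + 1 := by
    have := (abs_le.1 (abs_card_Ioc_filter_modEq_sub_le hD (Nat.zero_le Q) u)).2
    rw [Nat.cast_zero, sub_zero] at this
    linarith
  have hsum : |∑ m ∈ A, (#{n ∈ Ioc (Q - m) Q | n ≡ v [MOD D]} : ℝ) - (∑ m ∈ A, (m : ℝ)) / D|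
      ≤ Q / D + 1 := by
    rw [sum_div, ← sum_sub_distrib]
    calc _ ≤ ∑ m ∈ A, |(#{n ∈ Ioc (Q - m) Q | n ≡ v [MOD D]} : ℝ) - (m : ℝ) / D| :=
          abs_sum_le_sum_abs _ _
      _ ≤ ∑ m ∈ A, (1 : ℝ) := by
          refine sum_le_sum fun m hm ↦ ?_
          have hmQ : m ≤ Q := (mem_Ioc.1 (mem_filter.1 hm).1).2
          have := abs_card_Ioc_filter_modEq_sub_le hD (Nat.sub_le Q m) v
          rwa [Nat.cast_sub hmQ, sub_sub_cancel] at this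
      _ ≤ Q / D + 1 := by simpa using hAcard
  have hlin : |(∑ m ∈ A, (m : ℝ)) / D - (Q : ℝ) * (Q + 1) / 2 / D / D| ≤ Q / D := by
    rw [← sub_div, abs_div, abs_of_pos (by linarith : (0 : ℝ) < D)]
    gcongr
    exact abs_sum_filter_modEq_sub_le hD Q u
  have hmain : |(Q : ℝ) * (Q + 1) / 2 / D / D - (Q : ℝ) ^ 2 / (2 * (D : ℝ) ^ 2)| ≤ (Q : ℝ) / D := by
    have heq : (Q : ℝ) * (Q + 1) / 2 / D / D - (Q : ℝ) ^ 2 / (2 * (D : ℝ) ^ 2) =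
        (Q / D) * (1 / (2 * D)) := by
      field_simp
      ring
    rw [heq, abs_of_nonneg (by positivity)]
    refine mul_le_of_le_one_right (by positivity) ?_
    rw [div_le_one (by linarith)]
    linarith
  rw [hcard]
  rw [abs_le] at *
  constructor <;> linarith [hsum.1, hsum.2, hlin.1, hlin.2, hmain.1, hmain.2]

open ArithmeticFunction in
/-- The Dirichlet series `∑ μ(n) / n²` over `n` coprime to `d`. -/
theorem hasSum_moebius_div_sq_coprime {d : ℕ} (hd : 0 < d) :
    HasSum (fun n : ℕ ↦ if n.Coprime d then (moebius n : ℝ) / (n : ℝ) ^ 2 else 0)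
      (6 / Real.pi ^ 2 * ∏ p ∈ d.primeFactors, ((1 : ℝ) - 1 / (p : ℝ) ^ 2)⁻¹) := by
  have : NeZero d := ⟨hd.ne'⟩
  have hs : 1 < (2 : ℂ).re := by norm_num
  set χ : DirichletCharacter ℂ d := 1
  have hinv := DirichletCharacter.LSeries.mul_mu_eq_one χ hs
  have hL : LSeries (χ ·) 2 =
      (∏ p ∈ d.primeFactors, (1 - (p : ℂ) ^ (-2 : ℂ))) * riemannZeta 2 := by
    rw [← DirichletCharacter.LFunction_eq_LSeries χ hs]
    exact DirichletCharacter.LFunctionTrivChar_eq_mul_riemannZeta (by norm_num)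
  have hsum := (DirichletCharacter.LSeriesSummable_mul χ
    (LSeriesSummable_moebius_iff.2 hs)).LSeriesHasSum
  rw [LSeriesHasSum] at hsum
  rw [← Complex.hasSum_ofReal]
  convert hsum using 1
  · funext n
    rcases eq_or_ne n 0 with rfl | hn
    · simp
    · rw [LSeries.term_of_ne_zero hn]
      by_cases h : n.Coprime d
      · have hu : χ (n : ZMod d) = 1 := MulChar.one_apply ((ZMod.isUnit_iff_coprime n d).2 h)
        rw [if_pos h]
        simp [hu]
      · have hu : χ (n : ZMod d) = 0 :=
          MulChar.map_nonunit _ fun hh ↦ h ((ZMod.isUnit_iff_coprime n d).1 hh)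
        rw [if_neg h]
        simp [hu]
  · rw [eq_inv_of_mul_eq_one_right hinv, hL, riemannZeta_two, mul_inv, ← Finset.prod_inv_distrib,
      inv_div, mul_comm]
    push_cast
    congr 1
    refine Finset.prod_congr rfl fun p _ ↦ ?_
    rw [Complex.cpow_neg, one_div]
    norm_cast

/-- The tail of `∑ f(n)` beyond `Q` is at most `1 / Q` if `|f(n)| ≤ 1 / n²`. -/
theorem HasSum.abs_sum_Icc_sub_le_inv {f : ℕ → ℝ} {S : ℝ} (hf : HasSum f S) (h0 : f 0 = 0)
    (hle : ∀ n, |f n| ≤ ((n : ℝ) ^ 2)⁻¹) {Q : ℕ} (hQ : Q ≠ 0) :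
    |∑ n ∈ Finset.Icc 1 Q, f n - S| ≤ (Q : ℝ)⁻¹ := by
  have hrange (N : ℕ) : ∑ n ∈ Finset.range (N + 1), f n = ∑ n ∈ Finset.Ioc 0 N, f n := by
    have : Finset.range (N + 1) = insert 0 (Finset.Ioc 0 N) := by
      ext n
      simp only [Finset.mem_range, Finset.mem_insert, Finset.mem_Ioc]
      omega
    rw [this, Finset.sum_insert (by simp), h0, _root_.zero_add]
  have hlim : Filter.Tendsto (fun N ↦ |∑ n ∈ Finset.Icc 1 Q, f n - ∑ n ∈ Finset.Ioc 0 N, f n|)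
      Filter.atTop (nhds |∑ n ∈ Finset.Icc 1 Q, f n - S|) := by
    simp_rw [← hrange]
    exact (tendsto_const_nhds.sub
      (hf.tendsto_sum_nat.comp (Filter.tendsto_add_atTop_nat 1))).abs
  refine le_of_tendsto hlim (Filter.eventually_atTop.2 ⟨Q, fun N hN ↦ ?_⟩)
  have hsplit : ∑ n ∈ Finset.Ioc 0 N, f n =
      ∑ n ∈ Finset.Icc 1 Q, f n + ∑ n ∈ Finset.Ioc Q N, f n :=
    (Finset.sum_Ioc_consecutive f (Nat.zero_le Q) hN).symm
  rw [hsplit, sub_add_cancel_left, abs_neg]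
  calc _ ≤ ∑ n ∈ Finset.Ioc Q N, |f n| := Finset.abs_sum_le_sum_abs _ _
    _ ≤ ∑ n ∈ Finset.Ioc Q N, ((n : ℝ) ^ 2)⁻¹ := Finset.sum_le_sum fun n _ ↦ hle n
    _ ≤ (Q : ℝ)⁻¹ - (N : ℝ)⁻¹ := sum_Ioc_inv_sq_le_sub hQ hN
    _ ≤ (Q : ℝ)⁻¹ := sub_le_self _ (by positivity)

open ArithmeticFunction in
theorem sum_moebius_common_divisors {m n Q : ℕ} (hm : 1 ≤ m) (hmQ : m ≤ Q) :
    ∑ e ∈ Finset.Icc 1 Q, (if e ∣ m ∧ e ∣ n then (moebius e : ℝ) else 0) =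
      if m.Coprime n then 1 else 0 := by
  have hdiv : {e ∈ Finset.Icc 1 Q | e ∣ m ∧ e ∣ n} = (m.gcd n).divisors := by
    ext e
    simp only [Finset.mem_filter, Finset.mem_Icc, Nat.mem_divisors, Nat.dvd_gcd_iff]
    constructor
    · rintro ⟨_, h⟩
      exact ⟨h, (Nat.gcd_pos_of_pos_left n hm).ne'⟩
    · rintro ⟨h, _⟩
      exact ⟨⟨Nat.pos_of_dvd_of_pos h.1 hm, (Nat.le_of_dvd hm h.1).trans hmQ⟩, h⟩
  rw [← Finset.sum_filter, hdiv]
  have := congrArg (fun F : ArithmeticFunction ℤ ↦ F (m.gcd n)) moebius_mul_coe_zeta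
  simp only [coe_mul_zeta_apply, one_apply] at this
  exact_mod_cast this

open Finset in
/-- The points of the Farey triangle in a residue class modulo `d` whose coordinates are both
divisible by `e`, for `e` coprime to `d`. -/
theorem abs_card_farey_triangle_dvd_sub_le {d e : ℕ} (hd : 0 < d) (hed : e.Coprime d)
    {a b Q : ℕ} (ha : a < d) (hb : b < d) (he : 1 ≤ e) (heQ : e ≤ Q) :
    |(#{mn ∈ Icc 1 Q ×ˢ Icc 1 Q | Q < mn.1 + mn.2 ∧ (e ∣ mn.1 ∧ e ∣ mn.2) ∧
        mn.1 % d = a ∧ mn.2 % d = b} : ℝ)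
      - (Q : ℝ) ^ 2 / (2 * (d : ℝ) ^ 2) * (1 / (e : ℝ) ^ 2)| ≤ 4 * Q * (e : ℝ)⁻¹ := by
  have hclass {c : ℕ} (hc : c < d) : ∃ u, ∀ m, (e ∣ m ∧ m % d = c) ↔ m ≡ u [MOD e * d] := by
    obtain ⟨u, hu₁, hu₂⟩ := Nat.chineseRemainder hed 0 c
    refine ⟨u, fun m ↦ ?_⟩
    rw [← Nat.modEq_and_modEq_iff_modEq_mul hed, ← Nat.modEq_zero_iff_dvd]
    have hmc : m % d = c ↔ m ≡ c [MOD d] := by rw [Nat.ModEq, Nat.mod_eq_of_lt hc]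
    rw [hmc]
    exact ⟨fun h ↦ ⟨h.1.trans hu₁.symm, h.2.trans hu₂.symm⟩,
      fun h ↦ ⟨h.1.trans hu₁, h.2.trans hu₂⟩⟩
  obtain ⟨u, hu⟩ := hclass ha
  obtain ⟨v, hv⟩ := hclass hb
  have hset : {mn ∈ Icc 1 Q ×ˢ Icc 1 Q | Q < mn.1 + mn.2 ∧ (e ∣ mn.1 ∧ e ∣ mn.2) ∧
        mn.1 % d = a ∧ mn.2 % d = b} =
      {mn ∈ Icc 1 Q ×ˢ Icc 1 Q |
        Q < mn.1 + mn.2 ∧ mn.1 ≡ u [MOD e * d] ∧ mn.2 ≡ v [MOD e * d]} := by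
    refine filter_congr fun mn _ ↦ ?_
    rw [← hu, ← hv]
    tauto
  have hbound := abs_card_farey_triangle_modEq_sub_le (Nat.mul_pos he hd) Q u v
  rw [← hset] at hbound
  have he' : (1 : ℝ) ≤ e := by exact_mod_cast he
  have hd' : (1 : ℝ) ≤ d := by exact_mod_cast hd
  have heQ' : (e : ℝ) ≤ Q := by exact_mod_cast heQ
  have hmain : (Q : ℝ) ^ 2 / (2 * (d : ℝ) ^ 2) * (1 / (e : ℝ) ^ 2) =
      (Q : ℝ) ^ 2 / (2 * ((e * d : ℕ) : ℝ) ^ 2) := by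
    push_cast
    field_simp
  rw [hmain]
  refine hbound.trans ?_
  have h₁ : (Q : ℝ) / ((e * d : ℕ) : ℝ) ≤ Q / e := by
    push_cast
    gcongr
    exact le_mul_of_one_le_right (by linarith) hd'
  have h₂ : 1 ≤ (Q : ℝ) / e := (one_le_div (by linarith)).2 heQ'
  calc _ ≤ 4 * ((Q : ℝ) / e) := by linarith
    _ = _ := by ring


/-- The number of pairs of integers `(m, n)` with `1 ≤ m, n ≤ Q`, `m + n > Q`,
`gcd(m, n) = 1`, `m ≡ a (mod d)` and `n ≡ b (mod d)` equals
`(3Q²/(π²d²)) ∏_{p ∣ d} (1 − 1/p²)⁻¹ + O(Q log Q)`, with an implied constant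
depending only on `d`. -/
theorem farey_triangle_lattice_count (d : ℕ) (hd : 0 < d)
    (a b : ℕ) (ha : a < d) (hb : b < d) (hab : Nat.Coprime a b) :
    ∃ C : ℝ, ∀ Q : ℕ, 2 ≤ Q →
      |((((Finset.Icc 1 Q) ×ˢ (Finset.Icc 1 Q)).filter
            (fun mn : ℕ × ℕ => Q < mn.1 + mn.2 ∧ Nat.Coprime mn.1 mn.2 ∧
              mn.1 % d = a ∧ mn.2 % d = b)).card : ℝ)
          - 3 * (Q : ℝ) ^ 2 / (Real.pi ^ 2 * (d : ℝ) ^ 2) *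
              ∏ p ∈ d.primeFactors, ((1 : ℝ) - 1 / (p : ℝ) ^ 2)⁻¹|
        ≤ C * Q * Real.log Q := by
  set f : ℕ → ℝ := fun n ↦ if n.Coprime d then (ArithmeticFunction.moebius n : ℝ) / (n : ℝ) ^ 2
    else 0 with hf
  set S : ℝ := 6 / Real.pi ^ 2 * ∏ p ∈ d.primeFactors, ((1 : ℝ) - 1 / (p : ℝ) ^ 2)⁻¹ with hS
  have hmu (n : ℕ) : |(ArithmeticFunction.moebius n : ℝ)| ≤ 1 := by
    exact_mod_cast ArithmeticFunction.abs_moebius_le_one (n := n)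
  have hfle (n : ℕ) : |f n| ≤ ((n : ℝ) ^ 2)⁻¹ := by
    simp only [hf]
    split_ifs
    · rw [abs_div, abs_of_nonneg (by positivity : (0 : ℝ) ≤ (n : ℝ) ^ 2), div_eq_mul_inv]
      exact mul_le_of_le_one_left (by positivity) (hmu n)
    · simp
  refine ⟨14, fun Q hQ ↦ ?_⟩
  have hQ' : (2 : ℝ) ≤ Q := by exact_mod_cast hQ
  have hd' : (1 : ℝ) ≤ d := by exact_mod_cast hd
  set F : ℕ → ℝ := fun e ↦ (((Finset.Icc 1 Q ×ˢ Finset.Icc 1 Q).filter fun mn : ℕ × ℕ ↦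
    Q < mn.1 + mn.2 ∧ (e ∣ mn.1 ∧ e ∣ mn.2) ∧ mn.1 % d = a ∧ mn.2 % d = b).card : ℝ) with hF
  have hcount : ((((Finset.Icc 1 Q) ×ˢ (Finset.Icc 1 Q)).filter
      (fun mn : ℕ × ℕ => Q < mn.1 + mn.2 ∧ Nat.Coprime mn.1 mn.2 ∧
        mn.1 % d = a ∧ mn.2 % d = b)).card : ℝ) =
      ∑ e ∈ Finset.Icc 1 Q, (ArithmeticFunction.moebius e : ℝ) * F e := by
    simp only [hF, ← Finset.sum_boole, Finset.mul_sum]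
    rw [Finset.sum_comm]
    refine Finset.sum_congr rfl fun mn hmn ↦ ?_
    have hm := Finset.mem_Icc.1 (Finset.mem_product.1 hmn).1
    by_cases h : Q < mn.1 + mn.2 ∧ mn.1 % d = a ∧ mn.2 % d = b
    · simpa [h.1, h.2.1, h.2.2] using (sum_moebius_common_divisors (n := mn.2) hm.1 hm.2).symm
    · rw [if_neg (by tauto)]
      refine (Finset.sum_eq_zero fun e _ ↦ ?_).symm
      rw [if_neg (by tauto), mul_zero]
  have hterm : ∀ e ∈ Finset.Icc 1 Q,
      |(ArithmeticFunction.moebius e : ℝ) * F e - (Q : ℝ) ^ 2 / (2 * (d : ℝ) ^ 2) * f e| ≤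
        4 * Q * (e : ℝ)⁻¹ := by
    intro e he
    obtain ⟨he₁, heQ⟩ := Finset.mem_Icc.1 he
    by_cases hed : e.Coprime d
    · have heq : (ArithmeticFunction.moebius e : ℝ) * F e - (Q : ℝ) ^ 2 / (2 * (d : ℝ) ^ 2) * f e =
          (ArithmeticFunction.moebius e : ℝ) *
            (F e - (Q : ℝ) ^ 2 / (2 * (d : ℝ) ^ 2) * (1 / (e : ℝ) ^ 2)) := by
        simp only [hf, if_pos hed]
        ring
      rw [heq, abs_mul]
      exact (mul_le_of_le_one_left (abs_nonneg _) (hmu e)).trans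
        (abs_card_farey_triangle_dvd_sub_le hd hed ha hb he₁ heQ)
    · have hFe : F e = 0 := by
        simp only [hF, Nat.cast_eq_zero, Finset.card_eq_zero]
        refine Finset.filter_eq_empty_iff.2 fun mn _ ↦ ?_
        rintro ⟨_, ⟨h₁, h₂⟩, rfl, rfl⟩
        obtain ⟨p, hp, hpe, hpd⟩ := Nat.Prime.not_coprime_iff_dvd.1 hed
        exact Nat.not_coprime_of_dvd_of_dvd hp.one_lt
          ((Nat.dvd_mod_iff hpd).2 (hpe.trans h₁)) ((Nat.dvd_mod_iff hpd).2 (hpe.trans h₂)) hab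
      have hfe : f e = 0 := if_neg hed
      rw [hFe, hfe, mul_zero, mul_zero, sub_zero, abs_zero]
      positivity
  have hharm : ∑ e ∈ Finset.Icc 1 Q, (e : ℝ)⁻¹ ≤ 1 + Real.log Q := by
    have := harmonic_le_one_add_log Q
    rw [harmonic_eq_sum_Icc] at this
    push_cast at this
    exact this
  have hsum : |∑ e ∈ Finset.Icc 1 Q, (ArithmeticFunction.moebius e : ℝ) * F e -
      (Q : ℝ) ^ 2 / (2 * (d : ℝ) ^ 2) * ∑ e ∈ Finset.Icc 1 Q, f e| ≤
        4 * Q * (1 + Real.log Q) := by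
    rw [Finset.mul_sum, ← Finset.sum_sub_distrib]
    refine (Finset.abs_sum_le_sum_abs _ _).trans ((Finset.sum_le_sum hterm).trans ?_)
    rw [← Finset.mul_sum]
    gcongr
  have htail : |(Q : ℝ) ^ 2 / (2 * (d : ℝ) ^ 2) * ∑ e ∈ Finset.Icc 1 Q, f e -
      (Q : ℝ) ^ 2 / (2 * (d : ℝ) ^ 2) * S| ≤ (Q : ℝ) := by
    have hinv := (hasSum_moebius_div_sq_coprime hd).abs_sum_Icc_sub_le_inv (by simp) hfle
      (by omega : Q ≠ 0)
    rw [← mul_sub, abs_mul, abs_of_nonneg (by positivity)]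
    calc _ ≤ (Q : ℝ) ^ 2 * (Q : ℝ)⁻¹ := by
          gcongr
          exact div_le_self (by positivity) (by nlinarith)
      _ = Q := by field_simp
  have hmain : 3 * (Q : ℝ) ^ 2 / (Real.pi ^ 2 * (d : ℝ) ^ 2) *
      ∏ p ∈ d.primeFactors, ((1 : ℝ) - 1 / (p : ℝ) ^ 2)⁻¹ =
        (Q : ℝ) ^ 2 / (2 * (d : ℝ) ^ 2) * S := by
    rw [hS]
    field_simp
    ring
  have hlog : 1 / 2 ≤ Real.log Q := by
    have := Real.log_le_log (by norm_num) hQ'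
    linarith [Real.log_two_gt_d9]
  rw [hcount, hmain]
  refine (abs_sub_le _ _ _).trans ((add_le_add hsum htail).trans ?_)
  nlinarith
end

section
/- Let d ≥ 2 and 0 ≤ c ≤ d − 1 be integers and set g = gcd(c, d) (with gcd(0, d) = d). Then there is an absolute constant C such that for every integer Q ≥ 2, the cardinality of F^Q(c, d) equals (3 Q²/π²) · φ(g)/(d · g) · ∏_{p prime, p ∣ d} (1 − 1/p²)^{−1} + E with |E| ≤ C · d · Q · log Q. -/
/-- The Farey fractions of order `Q` with denominator `≡ c (mod d)`:
rationals `a/q` in lowest terms with `0 ≤ a/q ≤ 1`, `q ≤ Q` and `q ≡ c (mod d)`. -/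
def FareyFracCD (Q c d : ℕ) : Set ℚ := {x | 0 ≤ x ∧ x ≤ 1 ∧ x.den ≤ Q ∧ x.den % d = c}

/-- The local weight `gcd(k, d)` if `k * m ≡ c (mod d)` is solvable in `m`, and `0` otherwise. -/
def congrWeight (c d k : ℕ) : ℕ := if k.gcd d ∣ c then k.gcd d else 0

theorem congrWeight_one (c d : ℕ) : congrWeight c d 1 = 1 := by simp [congrWeight]

theorem congrWeight_le {c d : ℕ} (hd : 0 < d) (k : ℕ) : congrWeight c d k ≤ d := by
  unfold congrWeight
  split_ifs
  · exact Nat.gcd_le_right _ hd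
  · exact Nat.zero_le _

theorem congrWeight_mul {c d m n : ℕ} (h : m.Coprime n) :
    congrWeight c d (m * n) = congrWeight c d m * congrWeight c d n := by
  have hg : (m * n).gcd d = m.gcd d * n.gcd d := by
    rw [Nat.gcd_comm, h.gcd_mul, Nat.gcd_comm d, Nat.gcd_comm d]
  have hc : (m.gcd d).Coprime (n.gcd d) :=
    (h.coprime_dvd_left (Nat.gcd_dvd_left m d)).coprime_dvd_right (Nat.gcd_dvd_left n d)
  have hiff : m.gcd d * n.gcd d ∣ c ↔ m.gcd d ∣ c ∧ n.gcd d ∣ c :=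
    ⟨fun H => ⟨(dvd_mul_right _ _).trans H, (dvd_mul_left _ _).trans H⟩,
      fun H => hc.mul_dvd_of_dvd_of_dvd H.1 H.2⟩
  unfold congrWeight
  rw [hg]
  by_cases h1 : m.gcd d ∣ c <;> by_cases h2 : n.gcd d ∣ c <;> simp [hiff, h1, h2]

/-- The coefficient `μ(k) w(k) / k²` of the main term, `w` being `congrWeight c d`. -/
noncomputable def mainCoeff (c d k : ℕ) : ℝ :=
  (ArithmeticFunction.moebius k : ℝ) * congrWeight c d k / (k : ℝ) ^ 2

theorem abs_mainCoeff_le {c d : ℕ} (hd : 0 < d) (k : ℕ) :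
    |mainCoeff c d k| ≤ d * ((k : ℝ) ^ 2)⁻¹ := by
  have h1 : |(ArithmeticFunction.moebius k : ℝ)| ≤ 1 := by
    exact_mod_cast ArithmeticFunction.abs_moebius_le_one (n := k)
  have h2 : (congrWeight c d k : ℝ) ≤ d := by exact_mod_cast congrWeight_le hd k
  rw [mainCoeff, abs_div, abs_mul, Nat.abs_cast, abs_of_nonneg (sq_nonneg (k : ℝ)), div_eq_mul_inv]
  gcongr
  calc _ ≤ 1 * (d : ℝ) := by gcongr
    _ = d := one_mul _

theorem summable_mainCoeff {c d : ℕ} (hd : 0 < d) : Summable (mainCoeff c d) := by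
  refine Summable.of_norm_bounded
    ((Real.summable_nat_pow_inv.mpr (by norm_num : 1 < 2)).mul_left (d : ℝ)) fun k => ?_
  exact abs_mainCoeff_le hd k

theorem mainCoeff_mul {c d m n : ℕ} (h : m.Coprime n) :
    mainCoeff c d (m * n) = mainCoeff c d m * mainCoeff c d n := by
  simp only [mainCoeff, congrWeight_mul h,
    ArithmeticFunction.isMultiplicative_moebius.map_mul_of_coprime h]
  push_cast
  rw [mul_pow, div_mul_div_comm]
  ring

theorem tsum_mainCoeff_prime_pow {c d p : ℕ} (hp : p.Prime) :
    ∑' e, mainCoeff c d (p ^ e) = 1 - congrWeight c d p / (p : ℝ) ^ 2 := by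
  rw [tsum_eq_sum (s := Finset.range 2)]
  · simp [Finset.sum_range_succ, mainCoeff, congrWeight_one,
      ArithmeticFunction.moebius_apply_prime hp]
    ring
  · intro e he
    have he2 : 2 ≤ e := by simpa [Nat.succ_le_iff] using he
    rw [mainCoeff, ArithmeticFunction.moebius_apply_prime_pow hp (by omega), if_neg (by omega)]
    simp

theorem hasProd_one_sub_inv_sq_inv :
    HasProd (fun p : Nat.Primes => (1 - 1 / (p : ℝ) ^ 2)⁻¹) (Real.pi ^ 2 / 6) := by
  let f : ℕ →*₀ ℝ :=
    { toFun := fun n => 1 / (n : ℝ) ^ 2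
      map_zero' := by simp
      map_one' := by simp
      map_mul' := fun m n => by push_cast; rw [mul_pow, one_div_mul_one_div] }
  have hf : Summable (fun n => ‖f n‖) := hasSum_zeta_two.summable.norm
  have h := EulerProduct.eulerProduct_completely_multiplicative_hasProd hf
  rwa [show ∑' n, f n = Real.pi ^ 2 / 6 from hasSum_zeta_two.tsum_eq] at h

theorem prod_one_sub_congrWeight {c d : ℕ} (hd : 0 < d) :
    ∏ p ∈ d.primeFactors, (1 - congrWeight c d p / (p : ℝ) ^ 2)
      = (c.gcd d).totient / (c.gcd d : ℝ) := by
  have hg : (c.gcd d : ℝ) ≠ 0 := by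
    exact_mod_cast (Nat.gcd_pos_of_pos_right c hd).ne'
  have ht : ((c.gcd d).totient : ℝ)
      = c.gcd d * ∏ p ∈ (c.gcd d).primeFactors, (1 - (p : ℝ)⁻¹) := by
    have := congrArg (fun x : ℚ => (x : ℝ)) (Nat.totient_eq_mul_prod_factors (c.gcd d))
    simpa using this
  rw [ht, mul_div_cancel_left₀ _ hg]
  symm
  rw [← Finset.prod_subset (Nat.primeFactors_mono (Nat.gcd_dvd_right c d) hd.ne')]
  · refine Finset.prod_congr rfl fun p hp => ?_
    have hp' := Nat.prime_of_mem_primeFactors hp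
    have hpg := Nat.dvd_of_mem_primeFactors hp
    have hp0 : (p : ℝ) ≠ 0 := by exact_mod_cast hp'.ne_zero
    rw [congrWeight, Nat.gcd_eq_left (hpg.trans (Nat.gcd_dvd_right c d)),
      if_pos (hpg.trans (Nat.gcd_dvd_left c d))]
    field_simp
  · intro p hp hpg
    have hp' := Nat.prime_of_mem_primeFactors hp
    have hpd := Nat.dvd_of_mem_primeFactors hp
    have hpc : ¬ p ∣ c := fun h => hpg <|
      Nat.mem_primeFactors.mpr ⟨hp', Nat.dvd_gcd h hpd, (Nat.gcd_pos_of_pos_right c hd).ne'⟩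
    rw [congrWeight, Nat.gcd_eq_left hpd, if_neg hpc]
    simp

theorem tsum_mainCoeff {c d : ℕ} (hd : 0 < d) :
    ∑' k, mainCoeff c d k = 6 / Real.pi ^ 2 * ((c.gcd d).totient / (c.gcd d : ℝ))
      * ∏ p ∈ d.primeFactors, (1 - 1 / (p : ℝ) ^ 2)⁻¹ := by
  have h := EulerProduct.eulerProduct_hasProd (f := mainCoeff c d)
    (by simp [mainCoeff, congrWeight_one]) mainCoeff_mul (summable_mainCoeff hd).norm
    (by simp [mainCoeff])
  have h2 := h.mul hasProd_one_sub_inv_sq_inv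
  have h3 : HasProd (fun p : Nat.Primes => (∑' e, mainCoeff c d (p ^ e)) *
      (1 - 1 / (p : ℝ) ^ 2)⁻¹) (∏ p ∈ d.primeFactors.subtype Nat.Prime,
        (1 - congrWeight c d p / (p : ℝ) ^ 2) * (1 - 1 / (p : ℝ) ^ 2)⁻¹) := by
    have hprod : ∏ p ∈ d.primeFactors.subtype Nat.Prime,
        (1 - congrWeight c d p / (p : ℝ) ^ 2) * (1 - 1 / (p : ℝ) ^ 2)⁻¹ =
        ∏ p ∈ d.primeFactors.subtype Nat.Prime, (∑' e, mainCoeff c d (p ^ e)) *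
          (1 - 1 / (p : ℝ) ^ 2)⁻¹ :=
      Finset.prod_congr rfl fun p _ => by rw [tsum_mainCoeff_prime_pow p.2]
    rw [hprod]
    refine hasProd_prod_of_ne_finset_one fun p hp => ?_
    have hpd : ¬ (p : ℕ) ∣ d := fun hdvd => hp <|
      Finset.mem_subtype.mpr (Nat.mem_primeFactors.mpr ⟨p.2, hdvd, hd.ne'⟩)
    have hp2 : (2 : ℝ) ≤ (p : ℕ) := by exact_mod_cast p.2.two_le
    have hne : (1 : ℝ) - 1 / ((p : ℕ) : ℝ) ^ 2 ≠ 0 := by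
      have : 1 / ((p : ℕ) : ℝ) ^ 2 < 1 := by
        rw [div_lt_one (by positivity)]; nlinarith
      linarith
    rw [tsum_mainCoeff_prime_pow p.2, congrWeight, (p.2.coprime_iff_not_dvd.mpr hpd).gcd_eq_one,
      if_pos (one_dvd c), Nat.cast_one, mul_inv_cancel₀ hne]
  have h4 := h2.unique h3
  rw [Finset.prod_subtype_of_mem (fun p : ℕ => (1 - congrWeight c d p / (p : ℝ) ^ 2) *
      (1 - 1 / (p : ℝ) ^ 2)⁻¹) (fun p hp => Nat.prime_of_mem_primeFactors hp),
    Finset.prod_mul_distrib, prod_one_sub_congrWeight hd] at h4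
  have hpi := Real.pi_ne_zero
  rw [mul_assoc, ← h4]
  field_simp

theorem abs_tsum_mainCoeff_sub_sum_le {c d : ℕ} (hd : 0 < d) {Q : ℕ} (hQ : 0 < Q) :
    |∑' k, mainCoeff c d k - ∑ k ∈ Finset.Ioc 0 Q, mainCoeff c d k| ≤ (d : ℝ) / Q := by
  have hlim := ((summable_mainCoeff (c := c) hd).hasSum.tendsto_sum_nat.sub_const
    (∑ k ∈ Finset.Ioc 0 Q, mainCoeff c d k)).abs
  refine le_of_tendsto hlim ?_
  filter_upwards [Filter.eventually_gt_atTop Q] with n hn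
  obtain ⟨n, rfl⟩ : ∃ m, n = m + 1 := ⟨n - 1, by omega⟩
  have hQn : Q ≤ n := by omega
  have hsplit : ∑ k ∈ Finset.range (n + 1), mainCoeff c d k =
      ∑ k ∈ Finset.Ioc 0 Q, mainCoeff c d k + ∑ k ∈ Finset.Ioc Q n, mainCoeff c d k := by
    have h0 : mainCoeff c d 0 = 0 := by simp [mainCoeff]
    rw [Finset.sum_Ioc_consecutive _ (Nat.zero_le Q) hQn, Finset.range_eq_Ico,
      Finset.sum_eq_sum_Ico_succ_bot (Nat.succ_pos n), h0, zero_add]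
    rfl
  rw [hsplit, add_sub_cancel_left]
  calc |∑ k ∈ Finset.Ioc Q n, mainCoeff c d k|
      ≤ ∑ k ∈ Finset.Ioc Q n, |mainCoeff c d k| := Finset.abs_sum_le_sum_abs _ _
    _ ≤ ∑ k ∈ Finset.Ioc Q n, d * ((k : ℝ) ^ 2)⁻¹ :=
      Finset.sum_le_sum fun k _ => abs_mainCoeff_le hd k
    _ = d * ∑ k ∈ Finset.Ioc Q n, ((k : ℝ) ^ 2)⁻¹ := by rw [Finset.mul_sum]
    _ ≤ d * ((Q : ℝ)⁻¹ - (n : ℝ)⁻¹) := by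
      gcongr
      exact sum_Ioc_inv_sq_le_sub hQ.ne' hQn
    _ ≤ d * (Q : ℝ)⁻¹ := by
      gcongr
      simp
    _ = d / Q := (div_eq_mul_inv _ _).symm

theorem two_mul_sum_mod_eq {D a : ℕ} (ha : a < D) (N : ℕ) :
    (2 * ∑ m ∈ Finset.Ioc 0 N with m % D = a, (m : ℤ)) =
      ((N + D - a) / D : ℕ) * (2 * a + D * (((N + D - a) / D : ℕ) - 1 : ℤ)) := by
  induction N with
  | zero =>
    rcases Nat.eq_zero_or_pos a with rfl | h
    · simp [Nat.div_self ha]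
    · simp [Nat.div_eq_of_lt (show D - a < D by omega)]
  | succ N ih =>
    rw [Finset.sum_filter] at ih ⊢
    rw [Finset.sum_Ioc_succ_top (Nat.zero_le N), mul_add, ih,
      show N + 1 + D - a = N + D - a + 1 by omega]
    have hD : 0 < D := by omega
    by_cases h : D ∣ N + D - a + 1
    · have hdiv := Nat.succ_div_of_dvd h
      have hmod : (N + 1) % D = a := by
        have h2 : a ≡ N + 1 + D [MOD D] := (Nat.modEq_iff_dvd' (by omega)).mpr
          (by rwa [show N + 1 + D - a = N + D - a + 1 by omega])
        have h3 : a % D = (N + 1) % D := by simpa [Nat.ModEq] using h2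
        rw [← h3, Nat.mod_eq_of_lt ha]
      have hval : D * ((N + D - a) / D + 1) = N + D - a + 1 := by
        rw [← hdiv]; exact Nat.mul_div_cancel' h
      have hval2 : D * ((N + D - a) / D) + a = N + 1 := by
        rw [mul_add] at hval; omega
      rw [if_pos hmod, hdiv]
      generalize (N + D - a) / D = t at *
      have : (D * t + a : ℤ) = N + 1 := by exact_mod_cast hval2
      push_cast
      rw [← this]
      ring
    · have hdiv := Nat.succ_div_of_not_dvd h
      have hmod : (N + 1) % D ≠ a := fun H => h <| by
        have h2 : a ≡ N + 1 + D [MOD D] := by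
          simp [Nat.ModEq, H, Nat.mod_eq_of_lt ha]
        have h3 := (Nat.modEq_iff_dvd' (by omega)).mp h2
        rwa [show N + 1 + D - a = N + D - a + 1 by omega] at h3
      rw [if_neg hmod, hdiv]
      ring

theorem abs_sum_mod_eq_sub_le {D a : ℕ} (ha : a < D) (N : ℕ) :
    |∑ m ∈ Finset.Ioc 0 N with m % D = a, (m : ℝ) - (N : ℝ) ^ 2 / (2 * D)| ≤ (N : ℝ) := by
  have hkey : (2 * ∑ m ∈ Finset.Ioc 0 N with m % D = a, (m : ℝ)) =
      ((N + D - a) / D : ℕ) * (2 * a + D * (((N + D - a) / D : ℕ) - 1 : ℝ)) := by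
    have h := congrArg (fun n : ℤ => (n : ℝ)) (two_mul_sum_mod_eq ha N)
    push_cast at h
    exact h
  have hdm := Nat.div_add_mod (N + D - a) D
  have hr := Nat.mod_lt (N + D - a) (show D > 0 by omega)
  generalize (N + D - a) / D = t at *
  generalize (N + D - a) % D = r at *
  generalize ∑ m ∈ Finset.Ioc 0 N with m % D = a, (m : ℝ) = S at *
  have hD : (0 : ℝ) < D := by exact_mod_cast (show 0 < D by omega)
  have hS : S - (N : ℝ) ^ 2 / (2 * D) = (2 * S * D - (N : ℝ) ^ 2) / (2 * D) := by
    field_simp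
  rw [hS, abs_div, abs_of_pos (show (0 : ℝ) < 2 * D by positivity), div_le_iff₀ (by positivity),
    hkey]
  rcases t with _ | u
  · have hN : N ≤ D := by omega
    have hN' : (N : ℝ) ≤ D := by exact_mod_cast hN
    have hN0 : (0 : ℝ) ≤ N := by positivity
    rw [abs_le]
    constructor <;> push_cast <;> nlinarith
  · have hN : N = D * u + r + a := by rw [mul_add] at hdm; omega
    have ha' : (a : ℝ) ≤ D := by exact_mod_cast ha.le
    have hr' : (r : ℝ) ≤ D := by exact_mod_cast hr.le
    have hu : (0 : ℝ) ≤ u := by positivity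
    have hr0 : (0 : ℝ) ≤ r := by positivity
    have ha0 : (0 : ℝ) ≤ a := by positivity
    have e1 : ((u + 1 : ℕ) : ℝ) * (2 * a + D * (((u + 1 : ℕ) : ℝ) - 1)) * D - (N : ℝ) ^ 2 =
        D * (2 * a + (D - 2 * r) * u) - (r + a) ^ 2 := by
      rw [hN]; push_cast; ring
    have hNr : (N : ℝ) = D * u + r + a := by rw [hN]; push_cast; ring
    rw [e1, hNr, abs_le]
    have p1 : 0 ≤ D * u * (D - r) := mul_nonneg (by positivity) (by linarith)
    have p2 : 0 ≤ (r + a) * (2 * D - (r + a)) := mul_nonneg (by positivity) (by linarith)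
    have p3 : 0 ≤ D * u * r := by positivity
    have p4 : 0 ≤ (D : ℝ) * u * D := by positivity
    have p5 : 0 ≤ (D : ℝ) * r := by positivity
    have p6 : 0 ≤ (D : ℝ) * a := by positivity
    constructor <;> nlinarith

theorem exists_mul_mod_eq_iff {c d k : ℕ} (hc : c < d) (h : k.gcd d ∣ c) :
    ∃ a < d / k.gcd d, ∀ m, (k * m) % d = c ↔ m % (d / k.gcd d) = a := by
  have hd : 0 < d := by omega
  obtain ⟨m₀, hm₀⟩ : ∃ m₀, (k * m₀) % d = c := by
    obtain ⟨b, hb⟩ := h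
    have hg : 0 < k.gcd d := Nat.gcd_pos_of_pos_right k hd
    obtain ⟨m₁, hm₁⟩ : ∃ m₁, k * m₁ ≡ k.gcd d [MOD d] := by
      rcases (Nat.gcd_le_right k hd).lt_or_eq with hlt | heq
      · obtain ⟨m, -, hm⟩ := Nat.exists_mul_mod_eq_gcd hlt
        exact ⟨m, by rw [Nat.ModEq, hm, Nat.mod_eq_of_lt hlt]⟩
      · exact ⟨0, by rw [heq]; simp [Nat.ModEq]⟩
    refine ⟨m₁ * b, ?_⟩
    have := hm₁.mul_right b
    rw [← hb, mul_assoc] at this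
    rw [this, Nat.mod_eq_of_lt hc]
  have hD : 0 < d / k.gcd d :=
    Nat.div_pos (Nat.gcd_le_right k hd) (Nat.gcd_pos_of_pos_right k hd)
  refine ⟨m₀ % (d / k.gcd d), Nat.mod_lt _ hD, fun m => ⟨fun hm => ?_, fun hm => ?_⟩⟩
  · have h1 : k * m ≡ k * m₀ [MOD d] := hm.trans hm₀.symm
    have := h1.cancel_left_div_gcd hd
    rwa [Nat.gcd_comm] at this
  · have h1 : m ≡ m₀ [MOD d / k.gcd d] := hm
    have h2 := h1.mul_left' k
    have h3 : d ∣ k * (d / k.gcd d) := by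
      rw [← Nat.mul_div_assoc _ (Nat.gcd_dvd_right k d), mul_comm,
        Nat.mul_div_assoc _ (Nat.gcd_dvd_left k d)]
      exact dvd_mul_right _ _
    exact Eq.trans (h2.of_dvd h3) hm₀

theorem abs_sum_mul_mod_eq_sub_le {c d k Q : ℕ} (hc : c < d) (hk : 0 < k) :
    |∑ m ∈ Finset.Ioc 0 (Q / k) with (k * m) % d = c, (m : ℝ)
      - (Q : ℝ) ^ 2 / (2 * d) * (congrWeight c d k / (k : ℝ) ^ 2)| ≤ 2 * ((Q : ℝ) / k) := by
  have hd : 0 < d := by omega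
  have hk' : (0 : ℝ) < k := by exact_mod_cast hk
  unfold congrWeight
  by_cases h : k.gcd d ∣ c
  · rw [if_pos h]
    obtain ⟨a, ha, hiff⟩ := exists_mul_mod_eq_iff hc h
    simp_rw [hiff]
    have hprog := abs_sum_mod_eq_sub_le ha (Q / k)
    have hN : ((Q / k : ℕ) : ℝ) ≤ Q / k := Nat.cast_div_le
    have hN' : (Q : ℝ) / k ≤ (Q / k : ℕ) + 1 := by
      rw [div_le_iff₀ hk']
      have := (Nat.lt_mul_div_succ Q hk).le
      rw [mul_comm]
      exact_mod_cast this
    have hD : 1 ≤ d / k.gcd d := by omega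
    have hDd : ((d / k.gcd d : ℕ) : ℝ) * k.gcd d = d := by
      exact_mod_cast Nat.div_mul_cancel (Nat.gcd_dvd_right k d)
    have hg : (0 : ℝ) < k.gcd d := by exact_mod_cast Nat.gcd_pos_of_pos_right k hd
    generalize ∑ m ∈ Finset.Ioc 0 (Q / k) with m % (d / k.gcd d) = a, (m : ℝ) = S at *
    have hD1 : (1 : ℝ) ≤ (d / k.gcd d : ℕ) := by exact_mod_cast hD
    generalize ((d / k.gcd d : ℕ) : ℝ) = D at *
    have hN0 : (0 : ℝ) ≤ (Q / k : ℕ) := by positivity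
    generalize ((Q / k : ℕ) : ℝ) = N at *
    have hmain : (Q : ℝ) ^ 2 / (2 * d) * (k.gcd d / (k : ℝ) ^ 2) = (Q / k : ℝ) ^ 2 / (2 * D) := by
      rw [← hDd]
      field_simp
    rw [hmain]
    generalize (Q : ℝ) / k = y at *
    have h1 : y ^ 2 / (2 * D) - N ^ 2 / (2 * D) ≤ y := by
      rw [← sub_div, div_le_iff₀ (by positivity)]
      nlinarith [mul_nonneg (show (0 : ℝ) ≤ y by linarith) (sub_nonneg.mpr hD1)]
    have h2 : N ^ 2 / (2 * D) ≤ y ^ 2 / (2 * D) := by gcongr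
    rw [abs_le] at hprog ⊢
    constructor <;> linarith [hprog.1, hprog.2]
  · rw [if_neg h]
    have hempty : ∑ m ∈ Finset.Ioc 0 (Q / k) with (k * m) % d = c, (m : ℝ) = 0 := by
      refine Finset.sum_eq_zero fun m hm => absurd ?_ h
      rw [← (Finset.mem_filter.mp hm).2, Nat.dvd_mod_iff (Nat.gcd_dvd_right k d)]
      exact (Nat.gcd_dvd_left k d).mul_right m
    rw [hempty]
    simp
    positivity

theorem totient_eq_sum_moebius_mul {q : ℕ} (hq : 0 < q) :
    (q.totient : ℝ) = ∑ x ∈ q.divisorsAntidiagonal,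
      (ArithmeticFunction.moebius x.1 : ℝ) * x.2 :=
  ((ArithmeticFunction.sum_eq_iff_sum_mul_moebius_eq (R := ℝ)
    (f := fun n => (n.totient : ℝ)) (g := fun n => (n : ℝ))).mp
      (fun n _ => by exact_mod_cast n.sum_totient) q hq).symm

theorem sum_totient_filter (P : ℕ → Prop) [DecidablePred P] (Q : ℕ) :
    ∑ q ∈ Finset.Ioc 0 Q with P q, (q.totient : ℝ) =
      ∑ k ∈ Finset.Ioc 0 Q, (ArithmeticFunction.moebius k : ℝ) *
        ∑ m ∈ Finset.Ioc 0 (Q / k) with P (k * m), (m : ℝ) := by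
  have h1 : ∀ q ∈ Finset.Ioc 0 Q, (if P q then (q.totient : ℝ) else 0) =
      ∑ x ∈ Finset.Ioc 0 Q ×ˢ Finset.Ioc 0 Q, if x.1 * x.2 = q then
        (if P (x.1 * x.2) then (ArithmeticFunction.moebius x.1 : ℝ) * x.2 else 0) else 0 := by
    intro q hq
    rw [Finset.mem_Ioc] at hq
    rw [totient_eq_sum_moebius_mul hq.1,
      Nat.divisorsAntidiagonal_eq_prod_filter_of_le hq.1.ne' hq.2, ← Finset.sum_filter]
    split_ifs with hP
    · refine Finset.sum_congr rfl fun x hx => ?_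
      rw [(Finset.mem_filter.mp hx).2, if_pos hP]
    · symm
      refine Finset.sum_eq_zero fun x hx => ?_
      rw [(Finset.mem_filter.mp hx).2, if_neg hP]
  rw [Finset.sum_filter, Finset.sum_congr rfl h1, Finset.sum_comm, Finset.sum_product]
  refine Finset.sum_congr rfl fun k hk => ?_
  rw [Finset.mem_Ioc] at hk
  have h2 : ∀ m ∈ Finset.Ioc 0 Q, (∑ q ∈ Finset.Ioc 0 Q, if k * m = q then
        (if P (k * m) then (ArithmeticFunction.moebius k : ℝ) * m else 0) else 0) =
      if k * m ≤ Q then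
        (ArithmeticFunction.moebius k : ℝ) * (if P (k * m) then (m : ℝ) else 0) else 0 := by
    intro m hm
    rw [Finset.mem_Ioc] at hm
    have : 0 < k * m := Nat.mul_pos hk.1 hm.1
    rw [Finset.sum_ite_eq]
    simp [this]
  rw [Finset.sum_congr rfl h2, ← Finset.sum_filter, Finset.sum_filter (fun m => P (k * m)), Finset.mul_sum]
  refine Finset.sum_congr ?_ fun _ _ => rfl
  ext m
  rw [Finset.mem_filter, Finset.mem_Ioc, Finset.mem_Ioc, Nat.le_div_iff_mul_le hk.1, mul_comm m k]
  exact ⟨fun h => ⟨h.1.1, h.2⟩, fun h => ⟨⟨h.1, (Nat.le_mul_of_pos_left m hk.1).trans h.2⟩, h.2⟩⟩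

/-- The fractions of `FareyFracCD Q c d` below `1`, as a finite set. -/
def fareyLtOne (Q c d : ℕ) : Finset ℚ :=
  (((Finset.Ioc 0 Q).filter (· % d = c)).sigma
    fun q => (Finset.range q).filter q.Coprime).image fun x => (x.2 : ℚ) / x.1

theorem card_fareyLtOne (Q c d : ℕ) :
    (fareyLtOne Q c d).card = ∑ q ∈ Finset.Ioc 0 Q with q % d = c, q.totient := by
  rw [fareyLtOne, Finset.card_image_of_injOn, Finset.card_sigma]
  · rfl
  · rintro ⟨q, a⟩ hx ⟨q', a'⟩ hy hxy
    simp only [Finset.coe_sigma, Set.mem_sigma_iff, Finset.mem_coe, Finset.mem_filter,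
      Finset.mem_Ioc, Finset.mem_range] at hx hy
    have h : ((a : ℤ) : ℚ) / ((q : ℤ) : ℚ) = ((a' : ℤ) : ℚ) / ((q' : ℤ) : ℚ) := by
      simpa only [Int.cast_natCast] using hxy
    obtain ⟨h1, h2⟩ := Rat.div_int_inj (by exact_mod_cast hx.1.1.1) (by exact_mod_cast hy.1.1.1)
      (by simpa using hx.2.2.symm) (by simpa using hy.2.2.symm) h
    obtain rfl : a = a' := by exact_mod_cast h1
    obtain rfl : q = q' := by exact_mod_cast h2
    rfl

theorem mem_fareyLtOne {Q c d : ℕ} {x : ℚ} :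
    x ∈ fareyLtOne Q c d ↔ x ∈ FareyFracCD Q c d ∧ x ≠ 1 := by
  simp only [fareyLtOne, Finset.mem_image, Finset.mem_sigma, Finset.mem_filter, Finset.mem_Ioc,
    Finset.mem_range, FareyFracCD, Set.mem_ofPred_eq]
  constructor
  · rintro ⟨⟨q, a⟩, ⟨⟨⟨hq, hqQ⟩, hmod⟩, haq, hco⟩, rfl⟩
    dsimp only at *
    have hden : ((a : ℚ) / q).den = q := by
      have := Rat.den_div_eq_of_coprime (a := a) (b := q) (by exact_mod_cast hq)
        (by simpa using hco.symm)
      rw [Int.cast_natCast, Int.cast_natCast] at this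
      exact_mod_cast this
    have hq' : (0 : ℚ) < q := by exact_mod_cast hq
    have hlt : (a : ℚ) / q < 1 := by
      rw [div_lt_one hq']; exact_mod_cast haq
    exact ⟨⟨by positivity, hlt.le, by rwa [hden], by rwa [hden]⟩, hlt.ne⟩
  · rintro ⟨⟨h0, h1, hQ, hmod⟩, hne⟩
    have hnum : 0 ≤ x.num := Rat.num_nonneg.mpr h0
    have hlt : x.num < x.den := Rat.num_lt_denom_iff.mpr (lt_of_le_of_ne h1 hne)
    refine ⟨⟨x.den, x.num.natAbs⟩, ⟨⟨⟨x.den_pos, hQ⟩, hmod⟩, by dsimp only; omega, x.reduced.symm⟩, ?_⟩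
    have : ((x.num.natAbs : ℕ) : ℚ) = x.num := by
      rw [← Int.cast_natCast, Int.natAbs_of_nonneg hnum]
    simp only [this]
    exact x.num_div_den

theorem abs_card_fareyFracCD_sub_le (Q c d : ℕ) :
    |(Nat.card (FareyFracCD Q c d) : ℝ)
      - ∑ q ∈ Finset.Ioc 0 Q with q % d = c, (q.totient : ℝ)| ≤ 1 := by
  have hsub1 : (fareyLtOne Q c d : Set ℚ) ⊆ FareyFracCD Q c d :=
    fun x hx => (mem_fareyLtOne.mp hx).1
  have hsub2 : FareyFracCD Q c d ⊆ (insert 1 (fareyLtOne Q c d) : Finset ℚ) := by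
    intro x hx
    rw [Finset.mem_coe, Finset.mem_insert, or_iff_not_imp_left]
    exact fun h => mem_fareyLtOne.mpr ⟨hx, h⟩
  have hle1 := Set.ncard_le_ncard hsub1 ((Finset.finite_toSet _).subset hsub2)
  have hle2 := (Set.ncard_le_ncard hsub2 (Finset.finite_toSet _)).trans
    ((Set.ncard_coe_finset _).trans_le (Finset.card_insert_le _ _))
  rw [Set.ncard_coe_finset] at hle1
  rw [card_fareyLtOne] at hle1 hle2
  rw [Nat.card_coe_set_eq, ← Nat.cast_sum, abs_le]
  have h1 := (Nat.cast_le (α := ℝ)).mpr hle1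
  have h2 := (Nat.cast_le (α := ℝ)).mpr hle2
  rw [Nat.cast_add, Nat.cast_one] at h2
  constructor <;> linarith

theorem abs_sum_totient_mod_eq_sub_le {c d Q : ℕ} (hc : c < d) (hQ : 0 < Q) :
    |∑ q ∈ Finset.Ioc 0 Q with q % d = c, (q.totient : ℝ)
      - (Q : ℝ) ^ 2 / (2 * d) * ∑' k, mainCoeff c d k| ≤ 3 * Q + 2 * Q * Real.log Q := by
  have hd : 0 < d := by omega
  have hd' : (0 : ℝ) < d := by exact_mod_cast hd
  have hQ' : (0 : ℝ) < Q := by exact_mod_cast hQ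
  have htrunc : |∑ q ∈ Finset.Ioc 0 Q with q % d = c, (q.totient : ℝ)
      - (Q : ℝ) ^ 2 / (2 * d) * ∑ k ∈ Finset.Ioc 0 Q, mainCoeff c d k|
      ≤ 2 * Q * (1 + Real.log Q) := by
    rw [sum_totient_filter, Finset.mul_sum, ← Finset.sum_sub_distrib]
    calc _ ≤ ∑ k ∈ Finset.Ioc 0 Q, 2 * ((Q : ℝ) / k) := by
          refine (Finset.abs_sum_le_sum_abs _ _).trans (Finset.sum_le_sum fun k hk => ?_)
          have hk0 := (Finset.mem_Ioc.mp hk).1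
          have hμ : |(ArithmeticFunction.moebius k : ℝ)| ≤ 1 := by
            exact_mod_cast ArithmeticFunction.abs_moebius_le_one (n := k)
          rw [mainCoeff, mul_div_assoc, mul_left_comm, ← mul_sub, abs_mul]
          exact (mul_le_of_le_one_left (abs_nonneg _) hμ).trans
            (abs_sum_mul_mod_eq_sub_le hc hk0)
      _ = 2 * Q * (harmonic Q : ℝ) := by
          rw [harmonic_eq_sum_Icc, Rat.cast_sum, Finset.mul_sum]
          refine Finset.sum_congr rfl fun k _ => ?_
          push_cast
          ring
      _ ≤ _ := by
          gcongr
          exact harmonic_le_one_add_log Q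
  have htail : |(Q : ℝ) ^ 2 / (2 * d) * (∑' k, mainCoeff c d k
      - ∑ k ∈ Finset.Ioc 0 Q, mainCoeff c d k)| ≤ (Q : ℝ) := by
    rw [abs_mul, abs_of_pos (by positivity : (0 : ℝ) < (Q : ℝ) ^ 2 / (2 * d))]
    calc _ ≤ (Q : ℝ) ^ 2 / (2 * d) * (d / Q) := by
          gcongr
          exact abs_tsum_mainCoeff_sub_sum_le hd hQ
      _ = Q / 2 := by field_simp
      _ ≤ Q := by linarith
  rw [mul_sub] at htail
  rw [abs_le] at *
  constructor <;> linarith [htrunc.1, htrunc.2, htail.1, htail.2]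

/-- With `g = gcd(c, d)`, the cardinality of `F^Q(c, d)` equals
`(3Q²/π²) · φ(g)/(dg) · ∏_{p ∣ d} (1 − 1/p²)⁻¹ + O(d·Q·log Q)`, with an absolute
implied constant. -/
theorem card_farey_arith_progression :
    ∃ C : ℝ, ∀ d : ℕ, 2 ≤ d → ∀ c : ℕ, c ≤ d - 1 → ∀ Q : ℕ, 2 ≤ Q →
      |(Nat.card (FareyFracCD Q c d) : ℝ)
          - 3 * (Q : ℝ) ^ 2 / Real.pi ^ 2 *
              ((Nat.totient (Nat.gcd c d) : ℝ) / ((d : ℝ) * (Nat.gcd c d : ℝ))) *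
              ∏ p ∈ d.primeFactors, ((1 : ℝ) - 1 / (p : ℝ) ^ 2)⁻¹|
        ≤ C * d * Q * Real.log Q := by
  refine ⟨5, fun d hd c hc Q hQ => ?_⟩
  have hd' : (2 : ℝ) ≤ d := by exact_mod_cast hd
  have hQ' : (2 : ℝ) ≤ Q := by exact_mod_cast hQ
  have hcard := abs_card_fareyFracCD_sub_le Q c d
  have hsum := abs_sum_totient_mod_eq_sub_le (c := c) (d := d) (Q := Q) (by omega) (by omega)
  have hg : (0 : ℝ) < c.gcd d := by exact_mod_cast Nat.gcd_pos_of_pos_right c (by omega)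
  have hmain : (Q : ℝ) ^ 2 / (2 * d) * ∑' k, mainCoeff c d k =
      3 * (Q : ℝ) ^ 2 / Real.pi ^ 2 * (((c.gcd d).totient : ℝ) / (d * (c.gcd d : ℝ))) *
        ∏ p ∈ d.primeFactors, ((1 : ℝ) - 1 / (p : ℝ) ^ 2)⁻¹ := by
    rw [tsum_mainCoeff (by omega)]
    generalize ∏ p ∈ d.primeFactors, ((1 : ℝ) - 1 / (p : ℝ) ^ 2)⁻¹ = R
    have hpi := Real.pi_pos
    field_simp
    ring
  have hlog : 1 / 2 ≤ Real.log Q :=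
    (by linarith [Real.log_two_gt_d9] : (1 : ℝ) / 2 ≤ Real.log 2).trans
      (Real.log_le_log (by norm_num) hQ')
  rw [← hmain]
  have hQlog : (Q : ℝ) ≤ 2 * (Q * Real.log Q) := by nlinarith
  have hdQ : 2 * (Q * Real.log Q) ≤ d * (Q * Real.log Q) :=
    mul_le_mul_of_nonneg_right hd' (by linarith)
  have hfinal : 1 + (3 * Q + 2 * Q * Real.log Q) ≤ 5 * d * Q * Real.log Q := by
    rw [mul_assoc (5 : ℝ), mul_assoc (5 : ℝ), mul_assoc (d : ℝ), mul_assoc (2 : ℝ)]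
    linarith
  refine le_trans ?_ hfinal
  rw [abs_le] at *
  constructor <;> linarith [hcard.1, hcard.2, hsum.1, hsum.2]
end

section
/- Let d ≥ 2, 0 ≤ c ≤ d − 1 and s ≥ 1 be integers. Then the scaled sets D_s^Q(c,d)/Q ⊂ [0,1]^{s+1} converge, as Q → ∞, to a limiting set D_s(c,d) in the Kuratowski sense: there is a closed set D ⊆ [0,1]^{s+1} such that (i) every point of D is the limit of a sequence (x_Q) with x_Q ∈ D_s^Q(c,d)/Q for all large Q, and (ii) every accumulation point of any sequence (x_Q) with x_Q ∈ D_s^Q(c,d)/Q belongs to D. -/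
open Filter

/-- `f 0 < f 1 < ⋯ < f s` are `s + 1` consecutive fractions of `F^Q(c, d)`. -/
def FareyCDConsecTuple (Q c d s : ℕ) (f : Fin (s + 1) → ℚ) : Prop :=
  (∀ i, f i ∈ FareyFracCD Q c d) ∧
    ∀ i : Fin s, f i.castSucc < f i.succ ∧
      ∀ z ∈ FareyFracCD Q c d, ¬ (f i.castSucc < z ∧ z < f i.succ)

/-- `D_s^Q(c, d)`: the set of `(s+1)`-tuples of denominators of `s + 1` consecutive
fractions of `F^Q(c, d)`. -/
def DsQ (Q c d s : ℕ) : Set (Fin (s + 1) → ℕ) :=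
  {q | ∃ f : Fin (s + 1) → ℚ, FareyCDConsecTuple Q c d s f ∧ ∀ i, q i = (f i).den}

/-- The scaled set `D_s^Q(c, d)/Q ⊆ [0,1]^{s+1}`. -/
def DsQscaled (Q c d s : ℕ) : Set (Fin (s + 1) → ℝ) :=
  (fun q : Fin (s + 1) → ℕ => fun i => (q i : ℝ) / (Q : ℝ)) '' DsQ Q c d s

/-- The Möbius map `x ↦ (x + k) / (d (x + k) + 1)`, given by an element of `SL₂(ℤ)` whose lower
row is congruent to `(0, 1)` modulo `d`. -/
def fareyShift (d k : ℕ) (x : ℚ) : ℚ := (x + k) / (d * (x + k) + 1)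

theorem fareyShift_den (d k : ℕ) {x : ℚ} (hx : 0 ≤ x) :
    ((fareyShift d k x).den : ℤ) = d * x.num + (1 + k * d) * x.den := by
  have hden : (0 : ℤ) < x.den := by exact_mod_cast x.den_pos
  have hnum : 0 ≤ x.num := Rat.num_nonneg.mpr hx
  have hpos : (0 : ℤ) < d * (x.num + k * x.den) + x.den := by positivity
  have hcop : IsCoprime (x.num + k * x.den) (d * (x.num + k * x.den) + x.den : ℤ) := by
    have h1 : IsCoprime x.num (x.den : ℤ) := Rat.isCoprime_num_den x
    have h2 : IsCoprime (x.num + k * x.den) (x.den : ℤ) := h1.add_mul_right_left k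
    have h3 := h2.add_mul_right_right (d : ℤ)
    rwa [add_comm (x.den : ℤ)] at h3
  have heq : fareyShift d k x =
      ((x.num + k * x.den : ℤ) : ℚ) / ((d * (x.num + k * x.den) + x.den : ℤ) : ℚ) := by
    have e1 : (d : ℚ) * (x + k) + 1 ≠ 0 := by positivity
    have e2 : ((d * (x.num + k * x.den) + x.den : ℤ) : ℚ) ≠ 0 := by exact_mod_cast hpos.ne'
    have e3 : (x.num : ℚ) = x * x.den := (Rat.mul_den_eq_num x).symm
    unfold fareyShift
    rw [div_eq_div_iff e1 e2]
    push_cast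
    rw [e3]
    ring
  rw [heq, Rat.den_div_eq_of_coprime hpos (Int.isCoprime_iff_nat_coprime.mp hcop)]
  ring

theorem fareyShift_lt_iff (d k : ℕ) {x y : ℚ} (hx : 0 ≤ x) (hy : 0 ≤ y) :
    fareyShift d k x < fareyShift d k y ↔ x < y := by
  unfold fareyShift
  rw [div_lt_div_iff₀ (by positivity) (by positivity)]
  constructor <;> intro h <;> linarith

theorem exists_fareyShift_eq (d k : ℕ) {x y z : ℚ} (hx : 0 ≤ x) (hy : 0 ≤ y)
    (hxz : fareyShift d k x < z) (hzy : z < fareyShift d k y) :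
    ∃ w, x < w ∧ w < y ∧ fareyShift d k w = z := by
  have hx1 : (0 : ℚ) < d * (x + k) + 1 := by positivity
  have hy1 : (0 : ℚ) < d * (y + k) + 1 := by positivity
  have h1 : x + k < z * (d * (x + k) + 1) := (div_lt_iff₀ hx1).mp hxz
  have h2 : z * (d * (y + k) + 1) < y + k := (lt_div_iff₀ hy1).mp hzy
  have hz : 0 < 1 - d * z := by
    by_contra hneg
    push Not at hneg
    have hz0 : 0 < z := lt_of_le_of_lt (div_nonneg (by positivity) hx1.le) hxz
    nlinarith [mul_nonneg (by linarith : 0 ≤ d * z - 1) (by positivity : 0 ≤ y + k)]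
  have hxw : x < z / (1 - d * z) - k := by
    rw [lt_sub_iff_add_lt, lt_div_iff₀ hz]
    linarith
  have hwy : z / (1 - d * z) - k < y := by
    rw [sub_lt_iff_lt_add, div_lt_iff₀ hz]
    linarith
  refine ⟨_, hxw, hwy, ?_⟩
  unfold fareyShift
  have : (d : ℚ) * (z / (1 - d * z)) + 1 = 1 / (1 - d * z) := by
    field_simp
    ring
  rw [sub_add_cancel, this, div_div_div_cancel_right₀ hz.ne', div_one]

theorem fareyShift_den_bounds (d k : ℕ) {x : ℚ} (hx : 0 ≤ x) :
    (1 + k * d) * x.den ≤ (fareyShift d k x).den ∧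
      (x ≤ 1 → (fareyShift d k x).den ≤ (1 + k * d + d) * x.den) ∧
      (fareyShift d k x).den % d = x.den % d := by
  have h := fareyShift_den d k hx
  have hnum : 0 ≤ x.num := Rat.num_nonneg.mpr hx
  refine ⟨?_, fun hx1 => ?_, ?_⟩
  · zify
    rw [h]
    nlinarith [mul_nonneg (Int.natCast_nonneg d) hnum]
  · have hle : x.num ≤ x.den := Rat.num_le_denom_iff.mpr hx1
    zify
    rw [h]
    nlinarith [mul_le_mul_of_nonneg_left hle (Int.natCast_nonneg d)]
  · zify
    rw [h, show (d * x.num + (1 + k * d) * x.den : ℤ) = x.den + d * (x.num + k * x.den) by ring,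
      Int.add_mul_emod_self_left]

theorem FareyCDConsecTuple.fareyShift {Q c d s k Q' : ℕ} {f : Fin (s + 1) → ℚ}
    (hd : 1 ≤ d) (hf : FareyCDConsecTuple Q c d s f) (h1 : (1 + k * d + d) * Q ≤ Q')
    (h2 : Q' < (1 + k * d) * (Q + 1)) :
    FareyCDConsecTuple Q' c d s (fun i => fareyShift d k (f i)) := by
  obtain ⟨hmem, hcons⟩ := hf
  have h0 : ∀ i, 0 ≤ f i := fun i => (hmem i).1
  refine ⟨fun i => ?_, fun i => ⟨?_, ?_⟩⟩
  · obtain ⟨hi0, hi1, hiQ, hic⟩ := hmem i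
    obtain ⟨-, hb, hm⟩ := fareyShift_den_bounds d k hi0
    refine ⟨?_, ?_, ?_, hm.trans hic⟩
    · unfold _root_.fareyShift
      positivity
    · unfold _root_.fareyShift
      have hd1 : (1 : ℚ) ≤ d := by exact_mod_cast hd
      refine div_le_one_of_le₀ ?_ (by positivity)
      nlinarith [mul_le_mul_of_nonneg_right hd1 (by positivity : 0 ≤ f i + k)]
    · exact (hb hi1).trans ((Nat.mul_le_mul_left _ hiQ).trans h1)
  · exact (fareyShift_lt_iff d k (h0 _) (h0 _)).mpr (hcons i).1
  · rintro z ⟨-, -, hzQ, hzc⟩ ⟨hz1, hz2⟩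
    obtain ⟨w, hw1, hw2, rfl⟩ := exists_fareyShift_eq d k (h0 _) (h0 _) hz1 hz2
    have hw0 : 0 ≤ w := (h0 _).trans hw1.le
    obtain ⟨ha, -, hm⟩ := fareyShift_den_bounds d k hw0
    refine (hcons i).2 w ⟨hw0, hw2.le.trans (hmem _).2.1, ?_, hm.symm.trans hzc⟩ ⟨hw1, hw2⟩
    exact Nat.lt_succ_iff.mp (Nat.lt_of_mul_lt_mul_left ((ha.trans hzQ).trans_lt h2))

theorem exists_scale_between {d Q Q' : ℕ} (hd : 1 ≤ d) (hQ : 1 ≤ Q)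
    (hQ' : (1 + 2 * Q * d + d) * Q ≤ Q') :
    ∃ k, (1 + k * d + d) * Q ≤ Q' ∧ Q' < (1 + k * d) * (Q + 1) := by
  let P : ℕ → Prop := fun k => (1 + k * d + d) * Q ≤ Q'
  have hb : ∀ k, P k → k ≤ Q' := fun k hk => by
    have : k ≤ k * d := Nat.le_mul_of_pos_right k hd
    have : 1 + k * d + d ≤ (1 + k * d + d) * Q := Nat.le_mul_of_pos_right _ hQ
    change _ ≤ _ at hk
    omega
  classical
  have hP : P (2 * Q) := hQ'
  have h1 : P (Nat.findGreatest P Q') := Nat.findGreatest_spec (hb _ hP) hP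
  have h2 : 2 * Q ≤ Nat.findGreatest P Q' := Nat.le_findGreatest (hb _ hP) hP
  have h3 : ¬ P (Nat.findGreatest P Q' + 1) := fun h => by
    have := Nat.le_findGreatest (hb _ h) h
    omega
  refine ⟨_, h1, ?_⟩
  generalize Nat.findGreatest P Q' = k at *
  have h4 : Q' < (1 + (k + 1) * d + d) * Q := not_le.mp h3
  nlinarith [Nat.mul_le_mul_right d h2]

theorem eventually_exists_mem_DsQscaled {Q c d s : ℕ} (hd : 1 ≤ d) {x : Fin (s + 1) → ℝ}
    (hx : x ∈ DsQscaled Q c d s) :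
    ∀ᶠ Q' in atTop, ∃ y ∈ DsQscaled Q' c d s, dist y x ≤ 1 / ((Q : ℝ) + 1) := by
  obtain ⟨_, ⟨f, hf, hq⟩, rfl⟩ := hx
  have hQ : 1 ≤ Q := (f 0).den_pos.trans_le (hf.1 0).2.2.1
  filter_upwards [eventually_ge_atTop ((1 + 2 * Q * d + d) * Q)] with Q' hQ'
  obtain ⟨k, h1, h2⟩ := exists_scale_between hd hQ hQ'
  refine ⟨_, ⟨_, ⟨_, hf.fareyShift hd h1 h2, fun _ => rfl⟩, rfl⟩, ?_⟩
  rw [dist_pi_le_iff (by positivity)]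
  intro i
  obtain ⟨hi0, hi1, hiQ, -⟩ := hf.1 i
  obtain ⟨ha, hb, -⟩ := fareyShift_den_bounds d k hi0
  specialize hb hi1
  simp only [hq]
  generalize (fareyShift d k (f i)).den = r at *
  generalize (f i).den = q at *
  have hQr : (0 : ℝ) < Q := by exact_mod_cast hQ
  have hQ'r : (0 : ℝ) < Q' := by
    have : 0 < Q' := lt_of_lt_of_le (by positivity) h1
    exact_mod_cast this
  have hupper : (r : ℝ) / Q' ≤ q / Q := by
    rw [div_le_div_iff₀ hQ'r hQr]
    norm_cast
    nlinarith [Nat.mul_le_mul_right Q hb, Nat.mul_le_mul_right q h1]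
  have hlower : (q : ℝ) / (Q + 1) ≤ r / Q' := by
    rw [div_le_div_iff₀ (by positivity) hQ'r]
    norm_cast
    nlinarith [Nat.mul_le_mul_right (Q + 1) ha, Nat.mul_le_mul_right q h2.le]
  have hgap : (q : ℝ) / Q - q / (Q + 1) ≤ 1 / (Q + 1) := by
    have hqQ : (q : ℝ) / Q ≤ 1 := (div_le_one hQr).mpr (by exact_mod_cast hiQ)
    have : (q : ℝ) / Q - q / (Q + 1) = q / Q * (1 / (Q + 1)) := by
      field_simp
      ring
    rw [this]
    exact mul_le_of_le_one_left (by positivity) hqQ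
  rw [Real.dist_eq, abs_le]
  constructor <;> linarith [show (0 : ℝ) ≤ 1 / (Q + 1) by positivity]

theorem DsQscaled_mem_Icc {Q c d s : ℕ} {x : Fin (s + 1) → ℝ} (hx : x ∈ DsQscaled Q c d s)
    (i : Fin (s + 1)) : x i ∈ Set.Icc (0 : ℝ) 1 := by
  obtain ⟨q, ⟨f, hf, hq⟩, rfl⟩ := hx
  refine ⟨by positivity, div_le_one_of_le₀ ?_ (by positivity)⟩
  rw [hq]
  exact_mod_cast (hf.1 i).2.2.1

/-- The set of points approximated by the sets `S n` for all large `n`. -/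
def lowerKuratowskiLimit {X : Type*} [PseudoMetricSpace X] (S : ℕ → Set X) : Set X :=
  {x | ∀ ε > 0, ∀ᶠ n in atTop, ∃ y ∈ S n, dist y x < ε}

theorem isClosed_lowerKuratowskiLimit {X : Type*} [PseudoMetricSpace X] (S : ℕ → Set X) :
    IsClosed (lowerKuratowskiLimit S) := by
  refine isClosed_of_closure_subset fun x hx ε hε => ?_
  obtain ⟨z, hz, hxz⟩ := Metric.mem_closure_iff.mp hx (ε / 2) (half_pos hε)
  filter_upwards [hz (ε / 2) (half_pos hε)] with n ⟨y, hy, hyz⟩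
  refine ⟨y, hy, ?_⟩
  linarith [dist_triangle y z x, dist_comm x z]

theorem exists_tendsto_of_mem_lowerKuratowskiLimit {X : Type*} [PseudoMetricSpace X]
    {S : ℕ → Set X} {x : X} (hx : x ∈ lowerKuratowskiLimit S) :
    ∃ f : ℕ → X, (∀ᶠ n in atTop, f n ∈ S n) ∧ Tendsto f atTop (nhds x) := by
  have key : ∀ n, ∃ y, (S n).Nonempty →
      y ∈ S n ∧ dist x y < Metric.infDist x (S n) + 1 / ((n : ℝ) + 1) := fun n => by
    by_cases hne : (S n).Nonempty
    · obtain ⟨y, hy, hxy⟩ := (Metric.infDist_lt_iff hne).mp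
        (lt_add_of_pos_right (Metric.infDist x (S n)) (Nat.one_div_pos_of_nat (n := n)))
      exact ⟨y, fun _ => ⟨hy, hxy⟩⟩
    · exact ⟨x, fun h => absurd h hne⟩
  choose f hf using key
  refine ⟨f, (hx 1 one_pos).mono fun n ⟨y, hy, _⟩ => (hf n ⟨y, hy⟩).1, ?_⟩
  refine Metric.tendsto_nhds.mpr fun ε hε => ?_
  filter_upwards [hx (ε / 2) (half_pos hε),
    (tendsto_one_div_add_atTop_nhds_zero_nat (𝕜 := ℝ)).eventually_lt_const (half_pos hε)]
    with n ⟨y, hy, hyx⟩ hn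
  have h1 := (hf n ⟨y, hy⟩).2
  have h2 := Metric.infDist_le_dist_of_mem (x := x) hy
  rw [dist_comm] at hyx ⊢
  linarith

/-- The scaled sets `D_s^Q(c,d)/Q` converge, as `Q → ∞`, to a closed limiting set
`D_s(c,d) ⊆ [0,1]^{s+1}` in the Kuratowski sense: (i) every point of the limit set is
a limit of points of the scaled sets, and (ii) every accumulation point of a sequence
of points of the scaled sets lies in the limit set. -/
theorem limiting_set_exists (d : ℕ) (hd : 2 ≤ d) (c : ℕ) (hc : c ≤ d - 1)
    (s : ℕ) (hs : 1 ≤ s) :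
    ∃ D : Set (Fin (s + 1) → ℝ), IsClosed D ∧
      D ⊆ {x | ∀ i, x i ∈ Set.Icc (0 : ℝ) 1} ∧
      (∀ x ∈ D, ∃ f : ℕ → (Fin (s + 1) → ℝ),
        (∀ᶠ Q in atTop, f Q ∈ DsQscaled Q c d s) ∧ Tendsto f atTop (nhds x)) ∧
      (∀ f : ℕ → (Fin (s + 1) → ℝ), (∀ᶠ Q in atTop, f Q ∈ DsQscaled Q c d s) →
        ∀ x, MapClusterPt x atTop f → x ∈ D) := by
  refine ⟨lowerKuratowskiLimit fun Q => DsQscaled Q c d s, isClosed_lowerKuratowskiLimit _, ?_,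
    fun x hx => exists_tendsto_of_mem_lowerKuratowskiLimit hx, ?_⟩
  · intro x hx i
    obtain ⟨f, hf, hfx⟩ := exists_tendsto_of_mem_lowerKuratowskiLimit hx
    exact isClosed_Icc.mem_of_tendsto (tendsto_pi_nhds.mp hfx i)
      (hf.mono fun Q hQ => DsQscaled_mem_Icc hQ i)
  · intro f hf x hx ε hε
    have hfreq := hx.frequently (Metric.ball_mem_nhds x (half_pos hε))
    obtain ⟨Q, hQx, hQ, hQε⟩ := (hfreq.and_eventually (hf.and
      ((tendsto_one_div_add_atTop_nhds_zero_nat (𝕜 := ℝ)).eventually_lt_const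
        (half_pos hε)))).exists
    filter_upwards [eventually_exists_mem_DsQscaled (by omega) hQ] with Q' ⟨y, hy, hyQ⟩
    have hQx' : dist (f Q) x < ε / 2 := hQx
    exact ⟨y, hy, by linarith [dist_triangle y (f Q) x]⟩
end
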